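/- Let a = (w_1, w_2) be a weak CLT pair, i.e. w_1 and w_2 are closed words starting at the letter 1, every edge of the graph G_a of a is traversed at least twice by the pair (N_e^a ≥ 2 for all e ∈ E_a), and E_{w_1} ∩ E_{w_2} ≠ ∅. Then wt(a) ≤ (ℓ(w_1) + ℓ(w_2))/2 − 1. -/

import Mathlib

/-- The list of edges (unordered pairs of adjacent letters) traversed by the word `w`. -/
def edgeList (w : List ℕ) : List (Sym2 ℕ) :=
  (w.zip w.tail).map fun p => s(p.1, p.2)

/-- The edge set `E_w` of the graph `G_w` of the word `w`. -/
def edgeFinset (w : List ℕ) : Finset (Sym2 ℕ) := (edgeList w).toFinset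

/-- The traversal count `N_e^w`: the number of times the walk `w` traverses the edge `e`
(in either direction). -/
def trav (w : List ℕ) (e : Sym2 ℕ) : ℕ := (edgeList w).count e

/-- The support of a word: the set of letters appearing in it. -/
def wsupp (w : List ℕ) : Finset ℕ := w.toFinset

/-- A word is a closed word starting at the letter `1`: a finite sequence of positive
integers whose first and last letters are both equal to `1`. -/
def IsClosedWordAtOne (w : List ℕ) : Prop :=
  w ≠ [] ∧ w.head? = some 1 ∧ w.getLast? = some 1 ∧ ∀ x ∈ w, 0 < x

/-- `(w₁, w₂)` is a weak CLT pair: both are closed words starting at `1`, every edge of the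
combined graph is traversed at least twice in total, and the two words share an edge. -/
def IsWeakCLTPair (w₁ w₂ : List ℕ) : Prop :=
  IsClosedWordAtOne w₁ ∧ IsClosedWordAtOne w₂ ∧
    (∀ e ∈ edgeFinset w₁ ∪ edgeFinset w₂, 2 ≤ trav w₁ e + trav w₂ e) ∧
    (edgeFinset w₁ ∩ edgeFinset w₂).Nonempty

/-- The ends of a (possibly degenerate) edge are connected. -/
theorem reachable_of_mk_mem {S : Set (Sym2 ℕ)} {x y : ℕ} (h : s(x, y) ∈ S) :
    (SimpleGraph.fromEdgeSet S).Reachable x y := by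
  by_cases hxy : x = y
  · exact hxy ▸ SimpleGraph.Reachable.rfl
  · exact SimpleGraph.Adj.reachable ((SimpleGraph.fromEdgeSet_adj S).2 ⟨h, hxy⟩)

/-- A finite set of vertices connected to `r` through the edges of `F` has at most `#F + 1`
elements. -/
theorem card_le_card_edges_add_one (F : Finset (Sym2 ℕ)) (V : Finset ℕ) (r : ℕ)
    (h : ∀ v ∈ V, (SimpleGraph.fromEdgeSet (F : Set (Sym2 ℕ))).Reachable r v) :
    V.card ≤ F.card + 1 := by
  set H := SimpleGraph.fromEdgeSet (F : Set (Sym2 ℕ)) with hH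
  have parent : ∀ v, ∃ u, v ∈ V.erase r → H.Adj v u ∧ H.dist u r + 1 = H.dist v r := by
    intro v
    by_cases hv : v ∈ V.erase r
    · obtain ⟨hne, hmem⟩ := Finset.mem_erase.1 hv
      obtain ⟨p, hp⟩ := (h v hmem).symm.exists_walk_length_eq_dist
      cases p with
      | nil => exact absurd rfl hne
      | @cons _ u _ hadj q =>
        refine ⟨u, fun _ => ⟨hadj, ?_⟩⟩
        have hq := SimpleGraph.dist_le q
        have hr : H.Reachable u r := ⟨q⟩
        obtain ⟨q', hq'⟩ := hr.exists_walk_length_eq_dist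
        have hc := SimpleGraph.dist_le (SimpleGraph.Walk.cons hadj q')
        simp only [SimpleGraph.Walk.length_cons] at hp hc
        omega
    · exact ⟨v, fun hv' => absurd hv' hv⟩
  choose f hf using parent
  have hcard : (V.erase r).card ≤ F.card := by
    refine Finset.card_le_card_of_injOn (fun v => s(v, f v)) ?_ ?_
    · intro v hv
      exact ((SimpleGraph.fromEdgeSet_adj _).1 (hf v hv).1).1
    · intro v hv v' hv' heq
      rcases Sym2.eq_iff.1 heq with ⟨h1, -⟩ | ⟨h1, h2⟩
      · exact h1
      · have d := (hf v hv).2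
        have d' := (hf v' hv').2
        rw [h2] at d
        rw [← h1] at d'
        omega
  have := Finset.pred_card_le_card_erase (s := V) (a := r)
  omega

theorem edgeList_cons_cons (x y : ℕ) (l : List ℕ) :
    edgeList (x :: y :: l) = s(x, y) :: edgeList (y :: l) := rfl

theorem length_edgeList (w : List ℕ) : (edgeList w).length = w.length - 1 := by
  simp [edgeList]

/-- All letters of a word are connected to its first letter through its edges. -/
theorem reachable_of_mem_word {S : Set (Sym2 ℕ)} (x : ℕ) (l : List ℕ)
    (hS : ∀ e ∈ edgeList (x :: l), e ∈ S) :
    ∀ v ∈ x :: l, (SimpleGraph.fromEdgeSet S).Reachable x v := by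
  induction l generalizing x with
  | nil => simp
  | cons y l ih =>
    rw [edgeList_cons_cons] at hS
    intro v hv
    rcases List.mem_cons.1 hv with rfl | hv
    · exact SimpleGraph.Reachable.rfl
    · exact (reachable_of_mk_mem (hS _ List.mem_cons_self)).trans
        (ih y (fun e he => hS e (List.mem_cons_of_mem _ he)) v hv)

/-- A word traversing `s(a, b)` exactly once reaches one end of this edge from its first letter,
and its last letter from the other end, without using the edge. -/
theorem reachable_ends_of_count_eq_one {S : Set (Sym2 ℕ)} {a b z : ℕ} (x : ℕ) (l : List ℕ)
    (hz : (x :: l).getLast? = some z)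
    (hS : ∀ e ∈ edgeList (x :: l), e ≠ s(a, b) → e ∈ S)
    (hc : (edgeList (x :: l)).count s(a, b) = 1) :
    ((SimpleGraph.fromEdgeSet S).Reachable x a ∧ (SimpleGraph.fromEdgeSet S).Reachable b z) ∨
    ((SimpleGraph.fromEdgeSet S).Reachable x b ∧ (SimpleGraph.fromEdgeSet S).Reachable a z) := by
  induction l generalizing x with
  | nil => simp [edgeList] at hc
  | cons y l ih =>
    rw [edgeList_cons_cons] at hS hc
    rw [List.getLast?_cons_cons] at hz
    by_cases he : s(x, y) = s(a, b)
    · rw [he, List.count_cons_self, Nat.add_eq_right, List.count_eq_zero] at hc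
      have hyz : (SimpleGraph.fromEdgeSet S).Reachable y z :=
        reachable_of_mem_word y l
          (fun e h => hS e (List.mem_cons_of_mem _ h) fun h' => hc (h' ▸ h))
          z (List.mem_of_getLast? hz)
      rcases Sym2.eq_iff.1 he with ⟨rfl, rfl⟩ | ⟨rfl, rfl⟩
      · exact Or.inl ⟨SimpleGraph.Reachable.rfl, hyz⟩
      · exact Or.inr ⟨SimpleGraph.Reachable.rfl, hyz⟩
    · rw [List.count_cons_of_ne he] at hc
      have hxy := reachable_of_mk_mem (hS _ List.mem_cons_self he)
      rcases ih y hz (fun e h => hS e (List.mem_cons_of_mem _ h)) hc with h | h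
      · exact Or.inl ⟨hxy.trans h.1, h.2⟩
      · exact Or.inr ⟨hxy.trans h.1, h.2⟩

/-- Deleting an edge whose ends remain connected preserves connectedness. -/
theorem reachable_delete_edge {S T : Set (Sym2 ℕ)} {a b : ℕ}
    (hST : ∀ e ∈ S, e ≠ s(a, b) → e ∈ T)
    (hab : (SimpleGraph.fromEdgeSet T).Reachable a b) {x y : ℕ}
    (hxy : (SimpleGraph.fromEdgeSet S).Reachable x y) :
    (SimpleGraph.fromEdgeSet T).Reachable x y := by
  obtain ⟨p⟩ := hxy
  induction p with
  | nil => exact SimpleGraph.Reachable.rfl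
  | @cons u v _ hadj _ ih =>
    refine SimpleGraph.Reachable.trans ?_ ih
    by_cases he : s(u, v) = s(a, b)
    · rcases Sym2.eq_iff.1 he with ⟨rfl, rfl⟩ | ⟨rfl, rfl⟩
      · exact hab
      · exact hab.symm
    · exact reachable_of_mk_mem (hST _ ((SimpleGraph.fromEdgeSet_adj _).1 hadj).1 he)

theorem IsClosedWordAtOne.exists_eq_cons {w : List ℕ} (h : IsClosedWordAtOne w) :
    ∃ l, w = 1 :: l ∧ (1 :: l).getLast? = some 1 := by
  obtain ⟨-, hhead, hlast, -⟩ := h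
  obtain ⟨l, rfl⟩ := List.head?_eq_some_iff.1 hhead
  exact ⟨l, rfl, hlast⟩

/-- If a closed word traverses an edge exactly once, the ends of this edge are connected through
the other edges of the word. -/
theorem IsClosedWordAtOne.reachable_of_trav_eq_one {S : Set (Sym2 ℕ)} {w : List ℕ} {a b : ℕ}
    (h : IsClosedWordAtOne w) (hS : ∀ e ∈ edgeFinset w, e ≠ s(a, b) → e ∈ S)
    (hc : trav w s(a, b) = 1) : (SimpleGraph.fromEdgeSet S).Reachable a b := by
  obtain ⟨l, rfl, hlast⟩ := h.exists_eq_cons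
  rcases reachable_ends_of_count_eq_one 1 l hlast
    (fun e he => hS e (List.mem_toFinset.2 he)) hc with h | h
  · exact (h.2.trans h.1).symm
  · exact h.2.trans h.1

theorem IsClosedWordAtOne.reachable {S : Set (Sym2 ℕ)} {w : List ℕ} (h : IsClosedWordAtOne w)
    (hS : ∀ e ∈ edgeFinset w, e ∈ S) :
    ∀ v ∈ wsupp w, (SimpleGraph.fromEdgeSet S).Reachable 1 v := by
  obtain ⟨l, rfl, -⟩ := h.exists_eq_cons
  exact fun v hv => reachable_of_mem_word 1 l (fun e he => hS e (List.mem_toFinset.2 he)) v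
    (List.mem_toFinset.1 hv)

theorem sum_trav (w₁ w₂ : List ℕ) :
    ∑ e ∈ edgeFinset w₁ ∪ edgeFinset w₂, (trav w₁ e + trav w₂ e) =
      (w₁.length - 1) + (w₂.length - 1) := by
  have h := List.sum_toFinset_count_eq_length (edgeList w₁ ++ edgeList w₂)
  simpa only [edgeFinset, trav, List.toFinset_append, List.count_append, List.length_append,
    length_edgeList] using h

theorem weak_CLT_pair_weight_bound (w₁ w₂ : List ℕ) (h : IsWeakCLTPair w₁ w₂) :
    ((wsupp w₁ ∪ wsupp w₂).card : ℚ) ≤ ((w₁.length : ℚ) + w₂.length) / 2 - 1 := by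
  obtain ⟨h₁, h₂, htwo, e, he⟩ := h
  set E := edgeFinset w₁ ∪ edgeFinset w₂ with hE
  have hsum := sum_trav w₁ w₂
  rw [← hE] at hsum
  have hmem := Finset.mem_inter.1 he
  have heE : e ∈ E := Finset.mem_union_left _ hmem.1
  have c₁ : 1 ≤ trav w₁ e := List.one_le_count_iff.2 (List.mem_toFinset.1 hmem.1)
  have c₂ : 1 ≤ trav w₂ e := List.one_le_count_iff.2 (List.mem_toFinset.1 hmem.2)
  have l₁ := List.length_pos_of_ne_nil h₁.1
  have l₂ := List.length_pos_of_ne_nil h₂.1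
  have hreach : ∀ v ∈ wsupp w₁ ∪ wsupp w₂,
      (SimpleGraph.fromEdgeSet (E : Set (Sym2 ℕ))).Reachable 1 v := by
    intro v hv
    rcases Finset.mem_union.1 hv with hv | hv
    · exact h₁.reachable (fun e he => Finset.mem_union_left _ he) v hv
    · exact h₂.reachable (fun e he => Finset.mem_union_right _ he) v hv
  have hcard := Finset.card_erase_add_one heE
  have herase : (E.erase e).card * 2 ≤ ∑ e ∈ E.erase e, (trav w₁ e + trav w₂ e) :=
    Finset.card_nsmul_le_sum _ _ _ fun e he => htwo e (Finset.mem_of_mem_erase he)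
  rw [← Finset.add_sum_erase _ _ heE] at hsum
  have key : 2 * (wsupp w₁ ∪ wsupp w₂).card + 2 ≤ w₁.length + w₂.length := by
    by_cases hfour : 4 ≤ trav w₁ e + trav w₂ e
    · have := card_le_card_edges_add_one E _ 1 hreach
      omega
    · induction e with | _ a b
      have hab : (SimpleGraph.fromEdgeSet (E.erase s(a, b) : Set (Sym2 ℕ))).Reachable a b := by
        rcases (by omega : trav w₁ s(a, b) = 1 ∨ trav w₂ s(a, b) = 1) with hc | hc
        · exact h₁.reachable_of_trav_eq_one
            (fun e he hne => Finset.mem_erase.2 ⟨hne, Finset.mem_union_left _ he⟩) hc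
        · exact h₂.reachable_of_trav_eq_one
            (fun e he hne => Finset.mem_erase.2 ⟨hne, Finset.mem_union_right _ he⟩) hc
      have := card_le_card_edges_add_one (E.erase s(a, b)) _ 1 fun v hv =>
        reachable_delete_edge (fun e he hne => Finset.mem_erase.2 ⟨hne, he⟩) hab (hreach v hv)
      have := htwo _ heE
      omega
  have hkey : 2 * ((wsupp w₁ ∪ wsupp w₂).card : ℚ) + 2 ≤ w₁.length + w₂.length := by
    exact_mod_cast key
  linarith
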